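/- arXiv:1205.2717 — 2 statements merged into one kernel-verified Lean document; each statement's English description precedes it below -/
import Mathlib

section
/- Let M ≥ 1 be an integer and let α : ℕ → ℝ be a sequence with α_j = 0 for all j > M. Set f = (α_0/2)·T_0 + Σ_{j=1}^{M} α_j T_j and G = Σ_{n=2}^{M+2} ( α_{n−2}/(4n(n−1)) − α_n/(2(n²−1)) + α_{n+2}/(4n(n+1)) ) T_n. Then the second derivative of G equals f; that is, the Chebyshev coefficients of a twice-iterated antiderivative of f are given by 𝒯_n(∫∫f) = f_{n−2}/(4n(n−1)) − f_n/(2(n²−1)) + f_{n+2}/(4n(n+1)) for n ≥ 2. -/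
open Polynomial Finset

/-- Differentiating `U_{n+2} - U_n = 2 T_{n+2}`. -/
theorem derivative_U_add_two_sub (n : ℤ) :
    derivative (Chebyshev.U ℝ (n + 2)) - derivative (Chebyshev.U ℝ n)
      = (2 * ((n : ℝ) + 2)) • Chebyshev.U ℝ (n + 1) := by
  have h := congrArg derivative (Chebyshev.two_mul_T_eq_U_sub_U ℝ n)
  rw [derivative_sub, derivative_mul, Chebyshev.T_derivative_eq_U,
    show n + 2 - 1 = n + 1 by ring] at h
  rw [← h, smul_eq_C_mul]
  simp only [derivative_ofNat, map_mul, map_add, map_ofNat, map_intCast]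
  push_cast
  ring

theorem derivative_derivative_T (n : ℤ) :
    derivative (derivative (Chebyshev.T ℝ n))
      = (n : ℝ) • derivative (Chebyshev.U ℝ (n - 1)) := by
  rw [Chebyshev.T_derivative_eq_U, smul_eq_C_mul]
  simp

/-- `T_{k+2}` as a combination of second derivatives of Chebyshev polynomials. For `k = 0` the
last term vanishes. -/
theorem T_add_two_eq_derivative_derivative (k : ℕ) :
    Chebyshev.T ℝ ((k : ℤ) + 2)
      = (1 / (4 * ((k : ℝ) + 4) * ((k : ℝ) + 3))) •
          derivative (derivative (Chebyshev.T ℝ ((k : ℤ) + 4)))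
        - (1 / (2 * (((k : ℝ) + 2) ^ 2 - 1))) •
          derivative (derivative (Chebyshev.T ℝ ((k : ℤ) + 2)))
        + (1 / (4 * (k : ℝ) * ((k : ℝ) + 1))) •
          derivative (derivative (Chebyshev.T ℝ (k : ℤ))) := by
  have h₁ := derivative_U_add_two_sub ((k : ℤ) + 1)
  have h₂ := derivative_U_add_two_sub ((k : ℤ) - 1)
  have h₃ : Chebyshev.T ℝ ((k : ℤ) + 2)
      = (1 / 2 : ℝ) • (Chebyshev.U ℝ ((k : ℤ) + 2) - Chebyshev.U ℝ (k : ℤ)) := by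
    rw [← Chebyshev.two_mul_T_eq_U_sub_U, two_mul]
    module
  have h₄ : (1 / (4 * (k : ℝ) * ((k : ℝ) + 1))) •
        derivative (derivative (Chebyshev.T ℝ (k : ℤ)))
      = (1 / (4 * ((k : ℝ) + 1))) • derivative (Chebyshev.U ℝ ((k : ℤ) - 1)) := by
    rcases Nat.eq_zero_or_pos k with rfl | hk
    · simp
    · rw [derivative_derivative_T, smul_smul]
      congr 1
      have : (k : ℝ) ≠ 0 := by positivity
      push_cast
      field_simp
  rw [h₄, derivative_derivative_T, derivative_derivative_T, h₃]
  rw [show (k : ℤ) + 1 + 2 = k + 3 by ring, show (k : ℤ) + 1 + 1 = k + 2 by ring] at h₁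
  rw [show (k : ℤ) - 1 + 2 = k + 1 by ring, show (k : ℤ) - 1 + 1 = k by ring] at h₂
  rw [show (k : ℤ) + 4 - 1 = k + 3 by ring, show (k : ℤ) + 2 - 1 = k + 1 by ring]
  push_cast at h₁ h₂ ⊢
  have e₁ : ((k : ℝ) + 1) ≠ 0 := by positivity
  have e₃ : ((k : ℝ) + 3) ≠ 0 := by positivity
  have e₄ : ((k : ℝ) + 4) ≠ 0 := by positivity
  have e₂ : ((k : ℝ) + 2) ^ 2 - 1 = (k + 1) * (k + 3) := by ring
  rw [e₂]
  linear_combination (norm := skip) (-(1 / (4 * ((k : ℝ) + 3)))) • h₁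
    + (1 / (4 * ((k : ℝ) + 1))) • h₂
  match_scalars <;> field_simp <;> ring

/-- Second derivative of the partial sum, for arbitrary coefficients, with boundary terms. -/
theorem sum_smul_derivative_derivative_T (α : ℕ → ℝ) (k : ℕ) :
    ∑ n ∈ Finset.Icc 2 (k + 3),
        (α (n - 2) / (4 * (n : ℝ) * ((n : ℝ) - 1))
          - α n / (2 * ((n : ℝ) ^ 2 - 1))
          + α (n + 2) / (4 * (n : ℝ) * ((n : ℝ) + 1))) •
          derivative (derivative (Chebyshev.T ℝ (n : ℤ)))
      = (α 0 / 2) • Chebyshev.T ℝ 0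
        + ∑ j ∈ Finset.Icc 1 (k + 1), α j • Chebyshev.T ℝ (j : ℤ)
        + ∑ i ∈ Finset.range 2, (-(α (k + 2 + i) / (2 * (((k + 2 + i : ℕ) : ℝ) ^ 2 - 1)))) •
            derivative (derivative (Chebyshev.T ℝ ((k + 2 + i : ℕ) : ℤ)))
        + ∑ i ∈ Finset.range 4,
            (α (k + i + 2) / (4 * ((k + i : ℕ) : ℝ) * (((k + i : ℕ) : ℝ) + 1))) •
            derivative (derivative (Chebyshev.T ℝ ((k + i : ℕ) : ℤ))) := by
  induction k with
  | zero =>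
    have d2 : derivative (derivative (Chebyshev.T ℝ 2)) = (4 : ℝ) • (1 : ℝ[X]) := by
      rw [Chebyshev.T_two, smul_eq_C_mul]
      simp [map_ofNat]
      norm_num
    have d3 : derivative (derivative (Chebyshev.T ℝ 3)) = (24 : ℝ) • (X : ℝ[X]) := by
      rw [show (3 : ℤ) = 1 + 2 by norm_num, Chebyshev.T_add_two,
        show (1 : ℤ) + 1 = 2 by norm_num, Chebyshev.T_two, Chebyshev.T_one, smul_eq_C_mul,
        show (2 * X * (2 * X ^ 2 - 1) - X : ℝ[X]) = C 4 * X ^ 3 - C 3 * X by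
          simp only [map_ofNat]; ring]
      simp [map_ofNat]
      ring
    rw [show Finset.Icc 2 (0 + 3) = {2, 3} by decide]
    simp only [Finset.sum_range_succ, Finset.sum_range_zero]
    simp [d2, d3]
    match_scalars <;> norm_num <;> ring
  | succ k ih =>
    rw [show k + 1 + 3 = k + 3 + 1 by ring, Finset.sum_Icc_succ_top (by omega), ih,
      Finset.sum_Icc_succ_top (by omega : 1 ≤ k + 1 + 1)]
    have h := T_add_two_eq_derivative_derivative k
    simp only [Finset.sum_range_succ, Finset.sum_range_zero]
    simp only [add_assoc, Nat.reduceAdd, add_zero, show k + 4 - 2 = k + 2 by omega]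
    push_cast
    rw [show (k : ℝ) + 4 - 1 = k + 3 by ring]
    linear_combination (norm := module) -α (k + 2) • h

/-- The Chebyshev coefficients of a twice-iterated antiderivative of a truncated
Chebyshev series: if `f = (α_0/2)T_0 + Σ_{j=1}^M α_j T_j` with `α_j = 0` for `j > M`, then
`G = Σ_{n=2}^{M+2} (α_{n−2}/(4n(n−1)) − α_n/(2(n²−1)) + α_{n+2}/(4n(n+1))) T_n`
satisfies `G'' = f`. -/
theorem chebyshev_second_antiderivative_coeffs (M : ℕ) (hM : 1 ≤ M) (α : ℕ → ℝ)
    (hα : ∀ j, M < j → α j = 0) :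
    Polynomial.derivative (Polynomial.derivative
        (∑ n ∈ Finset.Icc 2 (M + 2),
          (α (n - 2) / (4 * (n : ℝ) * ((n : ℝ) - 1))
            - α n / (2 * ((n : ℝ) ^ 2 - 1))
            + α (n + 2) / (4 * (n : ℝ) * ((n : ℝ) + 1))) • Polynomial.Chebyshev.T ℝ (n : ℤ)))
      = (α 0 / 2) • Polynomial.Chebyshev.T ℝ 0
        + ∑ j ∈ Finset.Icc 1 M, α j • Polynomial.Chebyshev.T ℝ (j : ℤ) := by
  obtain ⟨k, rfl⟩ : ∃ k, M = k + 1 := ⟨M - 1, by omega⟩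
  simp only [derivative_sum, derivative_smul]
  rw [show k + 1 + 2 = k + 3 by ring, sum_smul_derivative_derivative_T]
  have h (i : ℕ) : α (k + 2 + i) = 0 := hα _ (by omega)
  have h' (i : ℕ) : α (k + i + 2) = 0 := hα _ (by omega)
  simp [h, h']
end

section
/- Let M ≥ 3 be an integer, let b, c ∈ ℝ, and let α : ℕ → ℝ be a sequence with α_0 = α_1 = 0 and α_j = 0 for all j ≥ M. Set u = Σ_{n=2}^{M−1} α_n T_n, and for 2 ≤ n ≤ M+1 define β_n = α_n + b·(α_{n−1} − α_{n+1})/(2n) + c·( α_{n−2}/(4n(n−1)) − α_n/(2(n²−1)) + α_{n+2}/(4n(n+1)) ). Then there exist real constants A and B such that u + b·F + c·G + A·T_0 + B·T_1 = Σ_{n=2}^{M+1} β_n T_n, where F = Σ_{n=1}^{M} ((α_{n−1} − α_{n+1})/(2n)) T_n is the antiderivative of u and G = Σ_{n=2}^{M+1} ( α_{n−2}/(4n(n−1)) − α_n/(2(n²−1)) + α_{n+2}/(4n(n+1)) ) T_n is a twice-iterated antiderivative of u. Consequently, the second derivative of Σ_{n=2}^{M+1} β_n T_n equals u'' + b u'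 + c u. -/
open Polynomial Finset

/-- The Chebyshev coefficients, in degrees `n ≥ 1`, of an antiderivative of `Σ a_n T_n`
when `a_0 = 0`; the coefficient in degree `0` is `0`. -/
noncomputable def chebyshevAntideriv (a : ℕ → ℝ) (n : ℕ) : ℝ :=
  (a (n - 1) - a (n + 1)) / (2 * (n : ℝ))

lemma derivative_chebyshevAntideriv_partial (a : ℕ → ℝ) (h0 : a 0 = 0) (N : ℕ) :
    derivative (∑ n ∈ range (N + 1), chebyshevAntideriv a n • Chebyshev.T ℝ (n : ℤ))
      = ∑ n ∈ range N, a n • Chebyshev.T ℝ (n : ℤ)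
        - ((a N / 2) • Chebyshev.U ℝ ((N : ℤ) - 2)
          + (a (N + 1) / 2) • Chebyshev.U ℝ ((N : ℤ) - 1)) := by
  induction N with
  | zero => simp [chebyshevAntideriv, h0]
  | succ N ih =>
    have hU : Chebyshev.U ℝ (N : ℤ) = 2 * Chebyshev.T ℝ (N : ℤ) + Chebyshev.U ℝ ((N : ℤ) - 2) := by
      have := Chebyshev.U_eq_two_mul_T_add_U ℝ ((N : ℤ) - 2)
      simpa using this
    have hT : derivative (chebyshevAntideriv a (N + 1) • Chebyshev.T ℝ ((N + 1 : ℕ) : ℤ))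
        = ((a N - a (N + 2)) / 2) • Chebyshev.U ℝ (N : ℤ) := by
      have hN : ((N : ℝ) + 1) ≠ 0 := by positivity
      have hcast : (((N + 1 : ℕ) : ℤ) : ℝ[X]) = Polynomial.C ((N : ℝ) + 1) := by simp
      rw [derivative_smul, Chebyshev.T_derivative_eq_U, hcast, ← smul_eq_C_mul, smul_smul]
      congr 1
      · simp only [chebyshevAntideriv, Nat.add_sub_cancel]
        push_cast
        field_simp
      · simp
    have e1 : ((N + 1 : ℕ) : ℤ) - 2 = (N : ℤ) - 1 := by push_cast; ring
    have e2 : ((N + 1 : ℕ) : ℤ) - 1 = (N : ℤ) := by push_cast; ring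
    rw [sum_range_succ _ (N + 1), derivative_add, ih, hT, sum_range_succ _ N, e1, e2, hU, two_mul]
    module

/-- A sequence vanishing at `0` and from `N` on is the Chebyshev series of the derivative
of the series with coefficients `chebyshevAntideriv a`. -/
lemma derivative_sum_chebyshevAntideriv (a : ℕ → ℝ) (h0 : a 0 = 0) (N : ℕ)
    (hN : ∀ j, N ≤ j → a j = 0) :
    derivative (∑ n ∈ range (N + 1), chebyshevAntideriv a n • Chebyshev.T ℝ (n : ℤ))
      = ∑ n ∈ range N, a n • Chebyshev.T ℝ (n : ℤ) := by
  simp [derivative_chebyshevAntideriv_partial a h0 N, hN N le_rfl, hN (N + 1) (Nat.le_succ N)]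

lemma chebyshevAntideriv_chebyshevAntideriv (a : ℕ → ℝ) {n : ℕ} (hn : 2 ≤ n) :
    chebyshevAntideriv (chebyshevAntideriv a) n
      = a (n - 2) / (4 * (n : ℝ) * ((n : ℝ) - 1)) - a n / (2 * ((n : ℝ) ^ 2 - 1))
        + a (n + 2) / (4 * (n : ℝ) * ((n : ℝ) + 1)) := by
  obtain ⟨k, rfl⟩ := Nat.exists_eq_add_of_le' hn
  have h1 : (k : ℝ) + 1 ≠ 0 := by positivity
  have h2 : (k : ℝ) + 2 ≠ 0 := by positivity
  have h3 : (k : ℝ) + 3 ≠ 0 := by positivity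
  have e1 : ((k : ℝ) + 2) - 1 = k + 1 := by ring
  have e2 : ((k : ℝ) + 2) + 1 = k + 3 := by ring
  have e3 : ((k : ℝ) + 2) ^ 2 - 1 = (k + 1) * (k + 3) := by ring
  have e4 : k + 2 - 1 = k + 1 := rfl
  simp only [chebyshevAntideriv, e4, Nat.add_sub_cancel]
  push_cast
  rw [e1, e2, e3]
  field_simp
  ring

/-- The pentadiagonal equations of second-order spectral integration: for
`u = Σ_{n=2}^{M−1} α_n T_n` (with `α_0 = α_1 = 0` and `α_j = 0` for `j ≥ M`) and
`β_n = α_n + b(α_{n−1} − α_{n+1})/(2n) + c(α_{n−2}/(4n(n−1)) − α_n/(2(n²−1)) + α_{n+2}/(4n(n+1)))`,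
there exist constants `A`, `B` with `u + bF + cG + A T_0 + B T_1 = Σ_{n=2}^{M+1} β_n T_n`,
where `F` and `G` are the antiderivative and twice-iterated antiderivative series of `u`.
Consequently the second derivative of `Σ β_n T_n` is `u'' + b u' + c u`. -/
theorem spectral_integration_second_order (M : ℕ) (hM : 3 ≤ M) (b c : ℝ) (α : ℕ → ℝ)
    (hα0 : α 0 = 0) (hα1 : α 1 = 0) (hα : ∀ j, M ≤ j → α j = 0) :
    (∃ A B : ℝ,
      (∑ n ∈ Finset.Icc 2 (M - 1), α n • Polynomial.Chebyshev.T ℝ (n : ℤ))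
        + b • (∑ n ∈ Finset.Icc 1 M,
            ((α (n - 1) - α (n + 1)) / (2 * (n : ℝ))) • Polynomial.Chebyshev.T ℝ (n : ℤ))
        + c • (∑ n ∈ Finset.Icc 2 (M + 1),
            (α (n - 2) / (4 * (n : ℝ) * ((n : ℝ) - 1))
              - α n / (2 * ((n : ℝ) ^ 2 - 1))
              + α (n + 2) / (4 * (n : ℝ) * ((n : ℝ) + 1))) • Polynomial.Chebyshev.T ℝ (n : ℤ))
        + A • Polynomial.Chebyshev.T ℝ 0 + B • Polynomial.Chebyshev.T ℝ 1
      = ∑ n ∈ Finset.Icc 2 (M + 1),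
          (α n + b * ((α (n - 1) - α (n + 1)) / (2 * (n : ℝ)))
            + c * (α (n - 2) / (4 * (n : ℝ) * ((n : ℝ) - 1))
                - α n / (2 * ((n : ℝ) ^ 2 - 1))
                + α (n + 2) / (4 * (n : ℝ) * ((n : ℝ) + 1)))) • Polynomial.Chebyshev.T ℝ (n : ℤ)) ∧
    Polynomial.derivative (Polynomial.derivative
        (∑ n ∈ Finset.Icc 2 (M + 1),
          (α n + b * ((α (n - 1) - α (n + 1)) / (2 * (n : ℝ)))
            + c * (α (n - 2) / (4 * (n : ℝ) * ((n : ℝ) - 1))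
                - α n / (2 * ((n : ℝ) ^ 2 - 1))
                + α (n + 2) / (4 * (n : ℝ) * ((n : ℝ) + 1)))) • Polynomial.Chebyshev.T ℝ (n : ℤ)))
      = Polynomial.derivative (Polynomial.derivative
            (∑ n ∈ Finset.Icc 2 (M - 1), α n • Polynomial.Chebyshev.T ℝ (n : ℤ)))
        + b • Polynomial.derivative
            (∑ n ∈ Finset.Icc 2 (M - 1), α n • Polynomial.Chebyshev.T ℝ (n : ℤ))
        + c • (∑ n ∈ Finset.Icc 2 (M - 1), α n • Polynomial.Chebyshev.T ℝ (n : ℤ)) := by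
  have hsplit (K : ℕ) (f : ℕ → ℝ[X]) :
      ∑ n ∈ range (K + 2), f n = f 0 + f 1 + ∑ n ∈ Icc 2 (K + 1), f n := by
    induction K with
    | zero => simp [sum_range_succ]
    | succ K ih => rw [sum_range_succ, ih, sum_Icc_succ_top (show 2 ≤ K + 1 + 1 by omega), add_assoc]
  have hF0 : chebyshevAntideriv α 0 = 0 := by simp [chebyshevAntideriv]
  have hFN : ∀ j, M + 1 ≤ j → chebyshevAntideriv α j = 0 := fun j hj => by
    simp [chebyshevAntideriv, hα (j - 1) (by omega), hα (j + 1) (by omega)]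
  have hu : ∑ n ∈ Icc 2 (M - 1), α n • Chebyshev.T ℝ (n : ℤ)
      = ∑ n ∈ range M, α n • Chebyshev.T ℝ (n : ℤ) := by
    obtain ⟨K, rfl⟩ := Nat.exists_eq_add_of_le' (show 2 ≤ M by omega)
    rw [hsplit K]
    simp [hα0, hα1]
  have hu' : ∑ n ∈ Icc 2 (M - 1), α n • Chebyshev.T ℝ (n : ℤ)
      = ∑ n ∈ Icc 2 (M + 1), α n • Chebyshev.T ℝ (n : ℤ) := by
    refine sum_subset (Icc_subset_Icc_right (by omega)) fun n hn hn' => ?_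
    rw [hα n (by simp only [mem_Icc] at hn hn'; omega), zero_smul]
  have hF : ∑ n ∈ Icc 1 M, ((α (n - 1) - α (n + 1)) / (2 * (n : ℝ))) • Chebyshev.T ℝ (n : ℤ)
      = ∑ n ∈ range (M + 1), chebyshevAntideriv α n • Chebyshev.T ℝ (n : ℤ) := by
    refine sum_subset (fun n hn => ?_) fun n hn hn' => ?_
    · simp only [mem_Icc, mem_range] at hn ⊢; omega
    · obtain rfl : n = 0 := by simp only [mem_Icc, mem_range] at hn hn'; omega
      simp
  have hF' : ∑ n ∈ range (M + 1), chebyshevAntideriv α n • Chebyshev.T ℝ (n : ℤ)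
      = chebyshevAntideriv α 1 • Chebyshev.T ℝ 1
        + ∑ n ∈ Icc 2 (M + 1), chebyshevAntideriv α n • Chebyshev.T ℝ (n : ℤ) := by
    have h := hsplit M fun n => chebyshevAntideriv α n • Chebyshev.T ℝ (n : ℤ)
    rw [sum_range_succ _ (M + 1), hFN (M + 1) le_rfl] at h
    simpa [hF0] using h
  have hG : ∑ n ∈ Icc 2 (M + 1), (α (n - 2) / (4 * (n : ℝ) * ((n : ℝ) - 1))
        - α n / (2 * ((n : ℝ) ^ 2 - 1))
        + α (n + 2) / (4 * (n : ℝ) * ((n : ℝ) + 1))) • Chebyshev.T ℝ (n : ℤ)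
      = ∑ n ∈ range (M + 2),
          chebyshevAntideriv (chebyshevAntideriv α) n • Chebyshev.T ℝ (n : ℤ)
        - chebyshevAntideriv (chebyshevAntideriv α) 1 • Chebyshev.T ℝ 1 := by
    rw [hsplit M, sum_congr rfl fun n hn => by
      rw [← chebyshevAntideriv_chebyshevAntideriv α (mem_Icc.1 hn).1]]
    have h0 : chebyshevAntideriv (chebyshevAntideriv α) 0 = 0 := by simp [chebyshevAntideriv]
    rw [h0]
    simp
  have hdF := derivative_sum_chebyshevAntideriv α hα0 M hα
  have hdG := derivative_sum_chebyshevAntideriv (chebyshevAntideriv α) hF0 (M + 1) hFN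
  refine (and_iff_left_of_imp fun hAB => ?_).2 ?_
  · obtain ⟨A, B, h⟩ := hAB
    rw [← h, hG, hF, hu]
    simp only [derivative_add, derivative_sub, derivative_smul, hdF, hdG]
    simp
  · refine ⟨0, -(b * chebyshevAntideriv α 1), ?_⟩
    rw [hF, hF', hu']
    simp only [add_smul, mul_smul, sum_add_distrib, ← smul_sum, chebyshevAntideriv]
    module
end
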